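/- Let w ≥ 1, let T be a string of length n over Σ, and let # and $ be distinct symbols with # < $ and with both # and $ strictly smaller than every character occurring in T. Set T' = T ++ [$] and W = [#] ++ T ++ ($ repeated w times). For 0 ≤ i ≤ n define y_i = drop i T', and define G(i) = drop (i+1) W for 0 ≤ i ≤ n − 1 and G(n) = W. Let S be a set of strings over Σ such that no element of S is a proper prefix of another element of S. Suppose s, s' ∈ S with s strictly lexicographically smaller than s', and suppose 0 ≤ i, j ≤ n are such that s is a prefix of G(i) and s' is a prefix of G(j). Then y_i is strictly lexicographically smaller than y_j. -/

import Mathlib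

theorem aux_ext {σ : Type*} [LinearOrder σ] (p q : List σ) {s s' : List σ}
    (h : List.Lex (· < ·) s s') (hn : ¬ s <+: s') :
    List.Lex (· < ·) (s ++ p) (s' ++ q) := by
  induction h with
  | nil => exact absurd (List.nil_prefix) hn
  | cons h ih =>
    exact List.Lex.cons (ih (fun hp => hn (List.cons_prefix_cons.2 ⟨rfl, hp⟩)))
  | rel h => exact List.Lex.rel h

theorem aux_irrefl {σ : Type*} [LinearOrder σ] (a : List σ) :
    ¬ List.Lex (· < ·) a a := by
  induction a with
  | nil => intro h; cases h
  | cons c a ih =>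
    intro h
    cases h with
    | cons h => exact ih h
    | rel h => exact lt_irrefl _ h

theorem aux_cmp {σ : Type*} [LinearOrder σ] (d : σ) (w : ℕ) (a : List σ) :
    ∀ b : List σ, (∀ c ∈ a, d < c) → (∀ c ∈ b, d < c) →
    List.Lex (· < ·) (a ++ List.replicate (w+1) d) (b ++ List.replicate (w+1) d) →
    List.Lex (· < ·) (a ++ [d]) (b ++ [d]) := by
  induction a with
  | nil =>
    intro b _ hb h
    cases b with
    | nil => exact absurd h (aux_irrefl _)
    | cons c b => exact List.Lex.rel (hb c (by simp))
  | cons x a ih =>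
    intro b ha hb h
    have hx := ha x (by simp)
    cases b with
    | nil =>
      simp only [List.nil_append, List.replicate_succ, List.cons_append] at h
      cases h with
      | cons h => exact absurd hx (lt_irrefl _)
      | rel h => exact absurd hx (lt_asymm h)
    | cons c b =>
      simp only [List.cons_append] at h ⊢
      cases h with
      | cons h =>
        exact List.Lex.cons (ih b (fun c hc => ha c (by simp [hc]))
          (fun c hc => hb c (by simp [hc])) h)
      | rel h => exact List.Lex.rel h

/-- comparing the `S`-prefixes of `G(i)` and `G(j)` determines the
lexicographic order of the corresponding suffixes of `T' = T$`. -/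
theorem stmt_8 {σ : Type*} [LinearOrder σ] (w : ℕ) (hw : 1 ≤ w)
    (T : List σ) (n : ℕ) (hn : T.length = n)
    (hash dollar : σ) (hhd : hash < dollar)
    (hsmall : ∀ c ∈ T, hash < c ∧ dollar < c)
    (T' W : List σ) (hT' : T' = T ++ [dollar])
    (hW : W = hash :: (T ++ List.replicate w dollar))
    (y G : ℕ → List σ)
    (hy : ∀ i ≤ n, y i = T'.drop i)
    (hG : ∀ i < n, G i = W.drop (i + 1)) (hGn : G n = W)
    (S : Set (List σ)) (hpf : ∀ u ∈ S, ∀ v ∈ S, u <+: v → u = v)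
    (s s' : List σ) (hs : s ∈ S) (hs' : s' ∈ S)
    (hss' : List.Lex (· < ·) s s')
    (i j : ℕ) (hi : i ≤ n) (hj : j ≤ n)
    (hsG : s <+: G i) (hs'G : s' <+: G j) :
    List.Lex (· < ·) (y i) (y j) := by
  have hnp : ¬ s <+: s' := by
    intro hp
    have e := hpf s hs s' hs' hp
    subst e
    exact aux_irrefl _ hss'
  have hlt : List.Lex (· < ·) (G i) (G j) := by
    obtain ⟨p, hp⟩ := hsG
    obtain ⟨q, hq⟩ := hs'G
    rw [← hp, ← hq]
    exact aux_ext p q hss' hnp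
  have hd : ∀ k, ∀ c ∈ T.drop k, dollar < c :=
    fun k c hc => (hsmall c (List.mem_of_mem_drop hc)).2
  have hyk : ∀ k ≤ n, y k = T.drop k ++ [dollar] := by
    intro k hk
    rw [hy k hk, hT', List.drop_append_of_le_length (by omega)]
  have hGk : ∀ k < n, G k = T.drop k ++ List.replicate w dollar := by
    intro k hk
    rw [hG k hk, hW, List.drop_succ_cons, List.drop_append_of_le_length (by omega)]
  rw [hyk i hi, hyk j hj]
  obtain ⟨w, rfl⟩ : ∃ v, w = v + 1 := ⟨w - 1, by omega⟩
  rcases Nat.lt_or_ge j n with hjn | hjn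
  · rcases Nat.lt_or_ge i n with hin | hin
    · rw [hGk i hin, hGk j hjn] at hlt
      exact aux_cmp dollar w _ _ (hd i) (hd j) hlt
    · have hi0 : T.drop i = [] := List.drop_eq_nil_of_le (by omega)
      have hj0 : T.drop j = T[j] :: T.drop (j+1) := List.drop_eq_getElem_cons (by omega)
      rw [hi0, hj0]
      exact List.Lex.rel (hsmall _ (List.getElem_mem _)).2
  · have e : j = n := by omega
    subst e
    rcases Nat.lt_or_ge i j with hin | hin
    · have hi0 : T.drop i = T[i] :: T.drop (i+1) := List.drop_eq_getElem_cons (by omega)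
      have hx : hash < T[i] := (hsmall _ (List.getElem_mem _)).1
      rw [hGk i hin, hGn, hW, hi0, List.cons_append] at hlt
      generalize T[i] = x at hlt hx
      cases hlt with
      | cons h => exact absurd hx (lt_irrefl _)
      | rel h => exact absurd hx (lt_asymm h)
    · have e : i = j := by omega
      subst e
      exact absurd hlt (aux_irrefl _)
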